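/- arXiv:2002.03882 — 2 statements merged into one kernel-verified Lean document; each statement's English description precedes it below -/
import Mathlib

section
/- Let G be a stable causal SISO LTI system given by a realization (A,B,C,D) with spectral radius of A strictly less than 1, impulse response h₀ = D, h_k = C A^{k−1} B for k ≥ 1. Let Ψ be a causal stable 2×2 filter whose four scalar entries Ψ₁₁, Ψ₁₂, Ψ₂₁, Ψ₂₂ are each given by realizations with spectral radius of the state matrix strictly less than 1, with impulse responses g^{Ψij}. Assume Ψ₁₁ admits a stable causal inverse, i.e., there is a realization with spectral radius < 1 whose impulse response φ satisfies (g^{Ψ11} ⋆ φ)₀ = 1 and (g^{Ψ11} ⋆ φ)_k = 0 for all k ≥ 1, and assume sup_{|z|=1} |Σ_{k=0}^∞ (g^{Ψ12} ⋆ h ⋆ φ)_k z^{−k}| < 1. Then there exists a constant c ≥ 0 such that for every horizon L ≥ 1 and every γ ≥ 0: if G satisfies the L-IQC given by the filter g^Ψ = [[g^{Ψ11}, g^{Ψ12}], [g^{Ψ21}, g^{Ψ22}]] and multiplier M = diag(γ², −1), then G satisfies the infinite-horizon IQC given by g^Ψ and M_inf = diag((γ + c/L²)², −1); i.e., the gap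 ε between the finite-horizon and infinite-horizon IQC level is of order O(1/L²). -/
open Matrix Finset

/-- Convolution of one-sided scalar sequences: `(f ⋆ g)_k = Σ_{j=0}^{k} f_j g_{k-j}`. -/
def conv (f g : ℕ → ℝ) (k : ℕ) : ℝ :=
  ∑ j ∈ Finset.range (k + 1), f j * g (k - j)

/-- Impulse response of the realization `(A, B, C, D)`: `h₀ = D`, `h_{k+1} = C A^k B`. -/
def impulse {q : ℕ} (A : Matrix (Fin q) (Fin q) ℝ) (B : Fin q → ℝ) (C : Fin q → ℝ)
    (D : ℝ) : ℕ → ℝ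
  | 0 => D
  | (k + 1) => C ⬝ᵥ (A ^ k).mulVec B

/-- The spectral radius of a real matrix (as a complex matrix) is strictly less than one. -/
def SpecRadLtOne {q : ℕ} (A : Matrix (Fin q) (Fin q) ℝ) : Prop :=
  spectralRadius ℂ (A.map Complex.ofReal) < 1

/-- A scalar impulse response admits a stable (spectral radius `< 1`) realization. -/
def HasStableRealization (g : ℕ → ℝ) : Prop :=
  ∃ (q : ℕ) (A : Matrix (Fin q) (Fin q) ℝ) (B : Fin q → ℝ) (C : Fin q → ℝ) (D : ℝ),
    SpecRadLtOne A ∧ g = impulse A B C D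

/-- The filtered signal `r_k = Σ_{j=0}^{k} g_j (u_{k-j}; y_{k-j})` for a `2 × 2` filter. -/
def sisoFiltered (g : ℕ → Matrix (Fin 2) (Fin 2) ℝ) (u y : ℕ → ℝ) (k : ℕ) : Fin 2 → ℝ :=
  ∑ j ∈ Finset.range (k + 1), (g j).mulVec ![u (k - j), y (k - j)]

/-- The SISO system with impulse response `h` satisfies the `L`-IQC given by `(g, M)`. -/
def SatisfiesLIQCsiso (h : ℕ → ℝ) (L : ℕ) (g : ℕ → Matrix (Fin 2) (Fin 2) ℝ)
    (M : Matrix (Fin 2) (Fin 2) ℝ) : Prop :=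
  ∀ u : ℕ → ℝ, ∀ hh < L,
    0 ≤ ∑ k ∈ Finset.range (hh + 1),
      (sisoFiltered g u (conv h u) k) ⬝ᵥ M.mulVec (sisoFiltered g u (conv h u) k)

/-- The SISO system with impulse response `h` satisfies the infinite-horizon IQC given
by `(g, M)`. -/
def SatisfiesIQCsiso (h : ℕ → ℝ) (g : ℕ → Matrix (Fin 2) (Fin 2) ℝ)
    (M : Matrix (Fin 2) (Fin 2) ℝ) : Prop :=
  ∀ u : ℕ → ℝ, Summable (fun k => (u k) ^ 2) → ∀ hh : ℕ,
    0 ≤ ∑ k ∈ Finset.range (hh + 1),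
      (sisoFiltered g u (conv h u) k) ⬝ᵥ M.mulVec (sisoFiltered g u (conv h u) k)


/-- Right shift by `j`. -/
def shiftR (j : ℕ) (v : ℕ → ℝ) (m : ℕ) : ℝ := if j ≤ m then v (m - j) else 0

/-- Padding: place `v` restricted to `[0,H)` at positions `[L, L+H)`. -/
def padLH (L H : ℕ) (v : ℕ → ℝ) (n : ℕ) : ℝ := if L ≤ n ∧ n < L + H then v (n - L) else 0

lemma conv_eq_shift (t v : ℕ → ℝ) (N k : ℕ) (hk : k < N) :
    conv t v k = ∑ j ∈ range N, t j * shiftR j v k := by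
  unfold conv shiftR
  rw [← Finset.sum_subset (s₁ := range (k+1)) (s₂ := range N)]
  · apply Finset.sum_congr rfl
    intro j hj
    rw [if_pos (by simp at hj; omega)]
  · intro j hj; simp at hj ⊢; omega
  · intro j _ hj
    rw [if_neg (by simp at hj; omega), mul_zero]

lemma sum_shift_supp (L H m : ℕ) (hm : m ≤ L) (f : ℕ → ℝ)
    (hf : ∀ n, ¬ (L ≤ n ∧ n < L + H) → f n = 0) :
    ∑ s ∈ range (H + L), f (s + m) = ∑ k ∈ range H, f (L + k) := by
  have : H + L = (L - m) + (H + m) := by omega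
  rw [this, Finset.sum_range_add, Finset.sum_range_add _ H m]
  rw [Finset.sum_eq_zero, zero_add]
  · have h2 : ∑ x ∈ range m, f (L - m + (H + x) + m) = 0 := by
      apply Finset.sum_eq_zero
      intro x hx
      apply hf; omega
    rw [h2, add_zero]
    apply Finset.sum_congr rfl
    intro k _
    congr 1; omega
  · intro x hx
    apply hf; simp at hx; omega

lemma window_key (L H j : ℕ) (w z v : ℕ → ℝ) :
    ∑ s ∈ range (H + L), ∑ m ∈ range L,
      (w m * padLH L H z (s + m)) * shiftR j (fun i => w i * padLH L H v (s + i)) m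
    = (∑ m ∈ range L, w m * shiftR j w m) * ∑ k ∈ range H, z k * shiftR j v k := by
  rw [Finset.sum_comm, Finset.sum_mul]
  apply Finset.sum_congr rfl
  intro m hm
  have hmL : m < L := by simpa using hm
  by_cases hj : j ≤ m
  · have key := sum_shift_supp L H m hmL.le
      (fun n => padLH L H z n * shiftR j (padLH L H v) n)
      (by intro n hn; simp [padLH, hn])
    have e2 : ∑ k ∈ range H, padLH L H z (L + k) * shiftR j (padLH L H v) (L + k)
        = ∑ k ∈ range H, z k * shiftR j v k := by
      apply Finset.sum_congr rfl
      intro k hk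
      have hk : k < H := by simpa using hk
      unfold padLH shiftR
      rw [if_pos (by omega), if_pos (by omega)]
      congr 1
      · congr 1; omega
      · by_cases h : j ≤ k
        · rw [if_pos h]; beta_reduce; rw [if_pos (by omega)]; congr 1; omega
        · rw [if_neg h]; beta_reduce; rw [if_neg (by omega)]
    rw [← e2, ← key, Finset.mul_sum]
    apply Finset.sum_congr rfl
    intro s _
    simp only [shiftR]
    rw [if_pos hj, if_pos hj, if_pos (by omega)]
    have : s + m - j = s + (m - j) := by omega
    rw [this]; ring
  · simp [shiftR, hj]

/-- Tent window. -/
def tent (L m : ℕ) : ℝ := ((min (m + 1) (L - m) : ℕ) : ℝ)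

lemma tent_diff (L j m : ℕ) : (tent L m - shiftR j (tent L) m) ^ 2 ≤ (j : ℝ) ^ 2 := by
  apply sq_le_sq'
  · unfold shiftR tent
    split_ifs with h
    · have : min (m - j + 1) (L - (m - j)) ≤ min (m+1) (L-m) + j := by omega
      have : ((min (m - j + 1) (L - (m - j)) : ℕ) : ℝ) ≤ ((min (m+1) (L-m) : ℕ) : ℝ) + j := by
        exact_mod_cast this
      linarith
    · have : (0:ℝ) ≤ ((min (m+1) (L-m) : ℕ) : ℝ) := by positivity
      have : (0:ℝ) ≤ (j:ℝ) := by positivity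
      linarith
  · unfold shiftR tent
    split_ifs with h
    · have : min (m+1) (L-m) ≤ min (m - j + 1) (L - (m - j)) + j := by omega
      have : ((min (m+1) (L-m) : ℕ) : ℝ) ≤ ((min (m - j + 1) (L - (m - j)) : ℕ) : ℝ) + j := by
        exact_mod_cast this
      linarith
    · have : min (m+1) (L-m) ≤ j := by omega
      have : ((min (m+1) (L-m) : ℕ) : ℝ) ≤ (j:ℝ) := by exact_mod_cast this
      linarith

lemma tent_zero (L m : ℕ) (h : L ≤ m) : tent L m = 0 := by
  unfold tent
  have : min (m+1) (L-m) = 0 := by omega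
  rw [this]; simp

lemma sum_tent_ext (L j : ℕ) (f : ℕ → ℝ) :
    ∑ m ∈ range (L + j), tent L m * f m = ∑ m ∈ range L, tent L m * f m := by
  rw [Finset.sum_range_add]
  simp [tent_zero]

lemma sum_shift_sq (L j : ℕ) (f : ℕ → ℝ) :
    ∑ m ∈ range (L + j), shiftR j f m ^ 2 = ∑ m ∈ range L, f m ^ 2 := by
  rw [add_comm, Finset.sum_range_add, Finset.sum_eq_zero, zero_add]
  · apply Finset.sum_congr rfl
    intro x _; simp [shiftR]
  · intro x hx; simp at hx; simp [shiftR, hx]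

lemma tent_gap (L j : ℕ) :
    2 * ((∑ m ∈ range L, tent L m ^ 2) - ∑ m ∈ range L, tent L m * shiftR j (tent L) m)
      = ∑ m ∈ range (L + j), (tent L m - shiftR j (tent L) m) ^ 2 := by
  have h1 : ∑ m ∈ range (L + j), tent L m ^ 2 = ∑ m ∈ range L, tent L m ^ 2 := by
    simpa [pow_two] using sum_tent_ext L j (tent L)
  have h2 := sum_tent_ext L j (shiftR j (tent L))
  have h3 := sum_shift_sq L j (tent L)
  simp only [sub_sq, Finset.sum_add_distrib, Finset.sum_sub_distrib, mul_assoc, ← Finset.mul_sum]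
  rw [h1, h2, h3]; ring

lemma tent_gap_nonneg (L j : ℕ) :
    0 ≤ (∑ m ∈ range L, tent L m ^ 2) - ∑ m ∈ range L, tent L m * shiftR j (tent L) m := by
  have := tent_gap L j
  have h : 0 ≤ ∑ m ∈ range (L + j), (tent L m - shiftR j (tent L) m) ^ 2 :=
    Finset.sum_nonneg (fun _ _ => sq_nonneg _)
  linarith

lemma tent_gap_le (L j : ℕ) (hL : 1 ≤ L) :
    (∑ m ∈ range L, tent L m ^ 2) - ∑ m ∈ range L, tent L m * shiftR j (tent L) m
      ≤ L * (j : ℝ) ^ 3 := by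
  have h := tent_gap L j
  have h2 : ∑ m ∈ range (L + j), (tent L m - shiftR j (tent L) m) ^ 2
      ≤ ∑ m ∈ range (L + j), (j : ℝ) ^ 2 := Finset.sum_le_sum (fun m _ => tent_diff L j m)
  simp only [sum_const, card_range, nsmul_eq_mul, Nat.cast_add] at h2
  have hL' : (1:ℝ) ≤ L := by exact_mod_cast hL
  rcases Nat.eq_zero_or_pos j with rfl | hj
  · simp at *; linarith
  · have hj' : (1:ℝ) ≤ j := by exact_mod_cast hj
    have : ((L:ℝ) + j) ≤ 2 * (L * j) := by nlinarith
    have : ((L:ℝ) + j) * (j:ℝ)^2 ≤ 2 * (L * j) * (j:ℝ)^2 := by gcongr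
    nlinarith

lemma sum_parab (X : ℝ) (n : ℕ) : ∑ m ∈ range n, ((m:ℝ) + 1) * (X - m)
    = X * n * (n + 1) / 2 - (n - 1) * n * (n + 1) / 3 := by
  induction n with
  | zero => simp
  | succ n ih => rw [Finset.sum_range_succ, ih]; push_cast; ring

lemma tent_sum (L : ℕ) (hL : 1 ≤ L) : (L:ℝ)^2 / 6 ≤ ∑ m ∈ range L, tent L m := by
  have hL' : (1:ℝ) ≤ L := by exact_mod_cast hL
  have h : ∑ m ∈ range L, ((m:ℝ) + 1) * (L - m) / (L + 1) ≤ ∑ m ∈ range L, tent L m := by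
    apply Finset.sum_le_sum
    intro m hm
    have hm : m < L := by simpa using hm
    have e : tent L m = min ((m:ℝ) + 1) (L - m) := by
      unfold tent; push_cast [Nat.cast_sub hm.le]; rfl
    have hm' : (m:ℝ) + 1 ≤ L := by exact_mod_cast hm
    have h0 : (0:ℝ) ≤ m := by positivity
    rw [e, div_le_iff₀ (by positivity)]
    rcases le_total ((m:ℝ) + 1) (L - m) with h | h
    · rw [min_eq_left h]; nlinarith
    · rw [min_eq_right h]; nlinarith
  refine le_trans ?_ h
  rw [← Finset.sum_div, sum_parab, le_div_iff₀ (by positivity)]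
  nlinarith [mul_pos (by linarith : (0:ℝ) < L) (by linarith : (0:ℝ) < L)]

lemma tent_W (L : ℕ) (hL : 1 ≤ L) : (L:ℝ)^3 / 36 ≤ ∑ m ∈ range L, tent L m ^ 2 := by
  have hL' : (1:ℝ) ≤ L := by exact_mod_cast hL
  have h := tent_sum L hL
  have h2 := sq_sum_le_card_mul_sum_sq (s := range L) (f := tent L)
  rw [card_range] at h2
  have h3 : ((L:ℝ)^2/6)^2 ≤ (∑ m ∈ range L, tent L m)^2 := by gcongr
  have h4 : (L:ℝ) * ((L:ℝ)^3 / 36) ≤ L * ∑ m ∈ range L, tent L m ^ 2 := by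
    calc _ = ((L:ℝ)^2/6)^2 := by ring
      _ ≤ _ := h3.trans h2
  exact le_of_mul_le_mul_left h4 (by linarith)

lemma sum_shift_sq_le (H j : ℕ) (f : ℕ → ℝ) :
    ∑ m ∈ range H, shiftR j f m ^ 2 ≤ ∑ m ∈ range H, f m ^ 2 := by
  rw [← sum_shift_sq H j f]
  apply Finset.sum_le_sum_of_subset_of_nonneg
  · intro x hx; simp at *; omega
  · intros; positivity

lemma bilin_of_gain (L : ℕ) (γ : ℝ) (hγ : 0 ≤ γ) (t : ℕ → ℝ)
    (h : ∀ v : ℕ → ℝ, ∑ k ∈ range L, conv t v k ^ 2 ≤ γ ^ 2 * ∑ k ∈ range L, v k ^ 2)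
    (z v : ℕ → ℝ) :
    ∑ k ∈ range L, z k * conv t v k
      ≤ γ / 2 * (∑ k ∈ range L, z k ^ 2 + ∑ k ∈ range L, v k ^ 2) := by
  have hz : 0 ≤ ∑ k ∈ range L, z k ^ 2 := Finset.sum_nonneg (fun _ _ => sq_nonneg _)
  have hv : 0 ≤ ∑ k ∈ range L, v k ^ 2 := Finset.sum_nonneg (fun _ _ => sq_nonneg _)
  apply le_of_sq_le_sq _ (by positivity)
  refine (Finset.sum_mul_sq_le_sq_mul_sq _ _ _).trans ?_
  calc _ ≤ (∑ k ∈ range L, z k ^ 2) * (γ ^ 2 * ∑ k ∈ range L, v k ^ 2) := by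
        gcongr; exact h v
    _ ≤ _ := by nlinarith [mul_nonneg (sq_nonneg γ) (sq_nonneg (∑ k ∈ range L, z k ^ 2 - ∑ k ∈ range L, v k ^ 2))]

lemma main_gain (t : ℕ → ℝ) (c : ℝ) (hc : ∀ N, 36 * ∑ j ∈ range N, |t j| * (j:ℝ)^3 ≤ c)
    (hc0 : 0 < c) (L : ℕ) (hL : 1 ≤ L) (γ : ℝ) (hγ : 0 ≤ γ)
    (h : ∀ v : ℕ → ℝ, ∑ k ∈ range L, conv t v k ^ 2 ≤ γ ^ 2 * ∑ k ∈ range L, v k ^ 2)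
    (H : ℕ) (v : ℕ → ℝ) :
    ∑ k ∈ range H, conv t v k ^ 2 ≤ (γ + c / (L:ℝ)^2) ^ 2 * ∑ k ∈ range H, v k ^ 2 := by
  have hL' : (1:ℝ) ≤ L := by exact_mod_cast hL
  -- bilinear bound on horizon H
  have bil : ∀ z : ℕ → ℝ, ∑ k ∈ range H, z k * conv t v k
      ≤ (γ + c / (L:ℝ)^2) / 2 * (∑ k ∈ range H, z k ^ 2 + ∑ k ∈ range H, v k ^ 2) := by
    intro z
    set W := ∑ m ∈ range L, tent L m ^ 2 with hW
    have hWL := tent_W L hL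
    have hWpos : 0 < W := lt_of_lt_of_le (by positivity) hWL
    set ρ : ℕ → ℝ := fun j => ∑ m ∈ range L, tent L m * shiftR j (tent L) m with hρ
    set R : ℕ → ℝ := fun j => ∑ k ∈ range H, z k * shiftR j v k with hR
    set E := (∑ k ∈ range H, z k ^ 2 + ∑ k ∈ range H, v k ^ 2) / 2 with hE
    have hE0 : 0 ≤ E := by positivity
    have e0 : ∀ (f : ℕ → ℝ) m, shiftR 0 f m = f m := by intro f m; simp [shiftR]
    have hRE : ∀ j, |R j| ≤ E := by
      intro j
      have hs := sum_shift_sq_le H j v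
      calc |R j| ≤ ∑ k ∈ range H, |z k * shiftR j v k| := Finset.abs_sum_le_sum_abs _ _
        _ ≤ ∑ k ∈ range H, (z k ^ 2 + shiftR j v k ^ 2) / 2 := by
            apply Finset.sum_le_sum
            intro k _
            rw [abs_le]
            constructor <;> nlinarith [sq_nonneg (z k + shiftR j v k), sq_nonneg (z k - shiftR j v k)]
        _ ≤ E := by
            rw [← Finset.sum_div, Finset.sum_add_distrib, hE]; linarith
    have hnorm : ∀ f : ℕ → ℝ, ∑ s ∈ range (H + L), ∑ m ∈ range L,
        (tent L m * padLH L H f (s + m)) ^ 2 = W * ∑ k ∈ range H, f k ^ 2 := by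
      intro f
      have := window_key L H 0 (tent L) f f
      simp only [e0, ← pow_two] at this
      exact this
    have hQ : ∑ j ∈ range (H + L), t j * (ρ j * R j) ≤ γ * W * E := by
      have e1 : ∑ j ∈ range (H + L), t j * (ρ j * R j) = ∑ s ∈ range (H + L), ∑ m ∈ range L,
          (tent L m * padLH L H z (s + m)) * conv t (fun i => tent L i * padLH L H v (s + i)) m := by
        have : ∀ s ∈ range (H + L), ∑ m ∈ range L,
          (tent L m * padLH L H z (s + m)) * conv t (fun i => tent L i * padLH L H v (s + i)) m
          = ∑ j ∈ range (H + L), t j * ∑ m ∈ range L, (tent L m * padLH L H z (s + m)) *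
              shiftR j (fun i => tent L i * padLH L H v (s + i)) m := by
          intro s _
          simp only [Finset.mul_sum]
          rw [Finset.sum_comm]
          apply Finset.sum_congr rfl
          intro m hm
          rw [conv_eq_shift _ _ (H + L) m (by simp at hm; omega), Finset.mul_sum]
          apply Finset.sum_congr rfl
          intro j _; ring
        rw [Finset.sum_congr rfl this, Finset.sum_comm]
        apply Finset.sum_congr rfl
        intro j _
        rw [← Finset.mul_sum, window_key]
      rw [e1]
      calc _ ≤ ∑ s ∈ range (H + L), γ / 2 * (∑ m ∈ range L, (tent L m * padLH L H z (s + m)) ^ 2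
            + ∑ m ∈ range L, (tent L m * padLH L H v (s + m)) ^ 2) :=
            Finset.sum_le_sum (fun s _ => bilin_of_gain L γ hγ t h _ _)
        _ = _ := by
            rw [← Finset.mul_sum, Finset.sum_add_distrib, hnorm, hnorm, hE]; ring
    have hB : ∑ k ∈ range H, z k * conv t v k = ∑ j ∈ range (H + L), t j * R j := by
      simp only [hR, Finset.mul_sum]
      rw [Finset.sum_comm]
      apply Finset.sum_congr rfl
      intro k hk
      rw [conv_eq_shift _ _ (H + L) k (by simp at hk; omega), Finset.mul_sum]
      apply Finset.sum_congr rfl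
      intro j _; ring
    have hrem : ∑ j ∈ range (H + L), t j * ((W - ρ j) * R j) ≤ c / (L:ℝ)^2 * W * E := by
      calc _ ≤ ∑ j ∈ range (H + L), |t j| * (j:ℝ)^3 * (L * E) := by
            apply Finset.sum_le_sum
            intro j _
            refine (le_abs_self _).trans ?_
            rw [abs_mul, abs_mul, abs_of_nonneg (tent_gap_nonneg L j), mul_assoc]
            refine mul_le_mul_of_nonneg_left ?_ (abs_nonneg _)
            calc _ ≤ (L * (j:ℝ)^3) * E :=
                  mul_le_mul (tent_gap_le L j hL) (hRE j) (abs_nonneg _) (by positivity)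
              _ = _ := by ring
        _ = (∑ j ∈ range (H + L), |t j| * (j:ℝ)^3) * (L * E) := by rw [Finset.sum_mul]
        _ ≤ (c / 36) * (L * E) := by gcongr; linarith [hc (H + L)]
        _ = c / (L:ℝ)^2 * ((L:ℝ)^3/36) * E := by field_simp
        _ ≤ _ := by gcongr
    have htot : W * ∑ k ∈ range H, z k * conv t v k ≤ W * ((γ + c / (L:ℝ)^2) * E) := by
      have : W * ∑ k ∈ range H, z k * conv t v k = ∑ j ∈ range (H + L), t j * (ρ j * R j)
          + ∑ j ∈ range (H + L), t j * ((W - ρ j) * R j) := by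
        rw [hB, Finset.mul_sum, ← Finset.sum_add_distrib]
        apply Finset.sum_congr rfl
        intro j _; ring
      rw [this]
      calc _ ≤ _ := add_le_add hQ hrem
        _ = _ := by ring
    have := le_of_mul_le_mul_left htot hWpos
    calc _ ≤ _ := this
      _ = _ := by rw [hE]; ring
  set G := γ + c / (L:ℝ)^2 with hG
  have hGpos : 0 < G := by positivity
  have := bil (fun k => conv t v k / G)
  have e1 : ∑ k ∈ range H, conv t v k / G * conv t v k = (∑ k ∈ range H, conv t v k ^ 2) / G := by
    rw [Finset.sum_div]; apply Finset.sum_congr rfl; intro k _; ring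
  have e2 : ∑ k ∈ range H, (conv t v k / G) ^ 2 = (∑ k ∈ range H, conv t v k ^ 2) / G ^ 2 := by
    rw [Finset.sum_div]; apply Finset.sum_congr rfl; intro k _; ring
  rw [e1, e2] at this
  set S := ∑ k ∈ range H, conv t v k ^ 2
  set V := ∑ k ∈ range H, v k ^ 2
  have e3 : G / 2 * (S / G ^ 2 + V) = (S + G ^ 2 * V) / 2 / G := by field_simp
  rw [e3, div_le_div_iff_of_pos_right hGpos] at this
  linarith

/-- Exponential decay. -/
def Dec (f : ℕ → ℝ) : Prop := ∃ R : ℝ, 1 < R ∧ Summable (fun k => |f k| * R ^ k)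

lemma dec_mono {f : ℕ → ℝ} {R S : ℝ} (hS : 0 ≤ S) (h : S ≤ R)
    (hf : Summable (fun k => |f k| * R ^ k)) : Summable (fun k => |f k| * S ^ k) := by
  refine Summable.of_nonneg_of_le (fun k => by positivity) (fun k => ?_) hf
  gcongr

lemma dec_common {f g : ℕ → ℝ} (hf : Dec f) (hg : Dec g) : ∃ R : ℝ, 1 < R ∧
    Summable (fun k => |f k| * R ^ k) ∧ Summable (fun k => |g k| * R ^ k) := by
  obtain ⟨R, hR, h⟩ := hf
  obtain ⟨S, hS, h'⟩ := hg
  have : 1 < min R S := lt_min hR hS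
  exact ⟨min R S, this, dec_mono (by linarith) (min_le_left _ _) h,
    dec_mono (by linarith) (min_le_right _ _) h'⟩

lemma dec_add {f g : ℕ → ℝ} (hf : Dec f) (hg : Dec g) : Dec (fun k => f k + g k) := by
  obtain ⟨R, hR, h1, h2⟩ := dec_common hf hg
  refine ⟨R, hR, Summable.of_nonneg_of_le (fun k => by positivity) (fun k => ?_) (h1.add h2)⟩
  rw [← add_mul]
  gcongr
  exact abs_add_le _ _

lemma dec_conv {f g : ℕ → ℝ} (hf : Dec f) (hg : Dec g) : Dec (conv f g) := by
  obtain ⟨R, hR, h1, h2⟩ := dec_common hf hg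
  refine ⟨R, hR, ?_⟩
  have hR0 : 0 ≤ R := by linarith
  have e : ∀ f : ℕ → ℝ, (fun k => |f k| * R ^ k) = fun k => ‖f k * R ^ k‖ := by
    intro f; funext k; rw [norm_mul, Real.norm_eq_abs, Real.norm_of_nonneg (by positivity)]
  rw [e] at h1 h2 ⊢
  refine (summable_norm_sum_mul_range_of_summable_norm h1 h2).congr (fun k => ?_)
  congr 1
  symm
  unfold conv
  rw [Finset.sum_mul]
  apply Finset.sum_congr rfl
  intro j hj
  have : k = j + (k - j) := by simp at hj; omega
  conv_lhs => rw [show R ^ k = R ^ (j + (k - j)) by rw [← this]]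
  rw [pow_add]; ring

lemma dec_moment {f : ℕ → ℝ} (hf : Dec f) : Summable (fun j => |f j| * (j:ℝ)^3) := by
  obtain ⟨R, hR, h⟩ := hf
  have hlim := tendsto_pow_const_div_const_pow_of_one_lt 3 hR
  obtain ⟨K, hK⟩ := hlim.bddAbove_range
  refine Summable.of_nonneg_of_le (fun k => by positivity) (fun k => ?_) (h.mul_left K)
  have : (k:ℝ)^3 / R^k ≤ K := hK ⟨k, rfl⟩
  rw [div_le_iff₀ (by positivity)] at this
  calc |f k| * (k:ℝ)^3 ≤ |f k| * (K * R^k) := by gcongr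
    _ = _ := by ring

section mat
attribute [local instance] Matrix.linftyOpNormedRing Matrix.linftyOpNormedAlgebra

lemma pow_decay {q : ℕ} (A : Matrix (Fin q) (Fin q) ℝ) (hA : SpecRadLtOne A) :
    ∃ r : ℝ, 0 < r ∧ r < 1 ∧ ∀ᶠ n : ℕ in Filter.atTop, ‖A ^ n‖ ≤ r ^ n := by
  unfold SpecRadLtOne at hA
  obtain ⟨r, hr1, hr2⟩ := exists_between hA
  have hrt : r ≠ ⊤ := (hr2.trans ENNReal.one_lt_top).ne
  lift r to NNReal using hrt
  have h := spectrum.pow_nnnorm_pow_one_div_tendsto_nhds_spectralRadius (A.map Complex.ofReal)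
  have h2 := h.eventually_lt_const hr1
  have hr0 : 0 < r := by exact_mod_cast lt_of_le_of_lt (zero_le) hr1
  refine ⟨r, by exact_mod_cast hr0, by exact_mod_cast hr2, ?_⟩
  filter_upwards [h2, Filter.eventually_gt_atTop 0] with n hn hn0
  have e : ‖(A.map Complex.ofReal) ^ n‖₊ = ‖A ^ n‖₊ := by
    have : (A.map Complex.ofReal) ^ n = (A ^ n).map Complex.ofReal := by
      have := (Complex.ofRealHom.mapMatrix (m := Fin q)).map_pow A n
      exact this.symm
    rw [this, Matrix.linfty_opNNNorm_def, Matrix.linfty_opNNNorm_def]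
    simp
  rw [e] at hn
  have h3 := ENNReal.rpow_le_rpow hn.le (z := (n:ℝ)) (by positivity)
  rw [← ENNReal.rpow_mul, one_div, inv_mul_cancel₀ (by positivity), ENNReal.rpow_one,
    ENNReal.rpow_natCast] at h3
  exact_mod_cast h3

lemma dec_impulse {q : ℕ} (A : Matrix (Fin q) (Fin q) ℝ) (B C : Fin q → ℝ) (D : ℝ)
    (hA : SpecRadLtOne A) : Dec (impulse A B C D) := by
  obtain ⟨r, hr0, hr1, h⟩ := pow_decay A hA
  obtain ⟨R, hR1, hR2⟩ := exists_between (show 1 < r⁻¹ by exact (one_lt_inv₀ hr0).2 hr1)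
  have hrR : r * R < 1 := by
    have := mul_lt_mul_of_pos_left hR2 hr0
    rwa [mul_inv_cancel₀ hr0.ne'] at this
  refine ⟨R, hR1, ?_⟩
  rw [← summable_nat_add_iff 1]
  have hg : Summable (fun k : ℕ => (∑ i, |C i|) * ‖B‖ * R * (r * R) ^ k) :=
    (summable_geometric_of_lt_one (by positivity) hrR).mul_left _
  refine Summable.of_norm_bounded_eventually_nat hg ?_
  filter_upwards [h] with n hn
  rw [Real.norm_of_nonneg (by positivity)]
  have h1 : |impulse A B C D (n+1)| ≤ (∑ i, |C i|) * (‖A ^ n‖ * ‖B‖) := by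
    show |C ⬝ᵥ (A ^ n).mulVec B| ≤ _
    unfold dotProduct
    refine (Finset.abs_sum_le_sum_abs _ _).trans ?_
    rw [Finset.sum_mul]
    apply Finset.sum_le_sum
    intro i _
    rw [abs_mul]
    gcongr
    exact (norm_le_pi_norm ((A ^ n).mulVec B) i).trans (Matrix.linfty_opNorm_mulVec _ _)
  calc _ ≤ (∑ i, |C i|) * (r ^ n * ‖B‖) * R ^ (n+1) := by
        gcongr
        refine h1.trans ?_
        gcongr
    _ = _ := by rw [mul_pow, pow_succ]; ring
end mat

lemma dec_of_stable {g : ℕ → ℝ} (h : HasStableRealization g) : Dec g := by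
  obtain ⟨q, A, B, C, D, hA, rfl⟩ := h
  exact dec_impulse A B C D hA

lemma coeff_unique {c d : ℕ → ℂ} {f : ℂ → ℂ}
    (hc : ∀ᶠ z in nhds (0:ℂ), HasSum (fun n => z ^ n * c n) (f z))
    (hd : ∀ᶠ z in nhds (0:ℂ), HasSum (fun n => z ^ n * d n) (f z)) : c = d := by
  have h1 : HasFPowerSeriesAt f (FormalMultilinearSeries.ofScalars ℂ c) 0 := by
    rw [hasFPowerSeriesAt_iff]
    simpa [FormalMultilinearSeries.coeff_ofScalars] using hc
  have h2 : HasFPowerSeriesAt f (FormalMultilinearSeries.ofScalars ℂ d) 0 := by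
    rw [hasFPowerSeriesAt_iff]
    simpa [FormalMultilinearSeries.coeff_ofScalars] using hd
  have := h1.eq_formalMultilinearSeries h2
  funext n
  have := congrArg (fun p => p.coeff n) this
  simpa [FormalMultilinearSeries.coeff_ofScalars] using this

lemma dec_inv (w : ℕ → ℝ) (hw : Dec w)
    (hsmall : (⨆ z : Metric.sphere (0 : ℂ) 1, ‖∑' k : ℕ, ((w k : ℝ) : ℂ) * ((z : ℂ)⁻¹) ^ k‖) < 1) :
    ∃ p : ℕ → ℝ, Dec p ∧
      conv (fun k => (if k = 0 then (1:ℝ) else 0) + w k) p = fun k => if k = 0 then (1 : ℝ) else 0 := by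
  obtain ⟨R, hR, hs⟩ := hw
  set F : ℂ → ℂ := fun x => ∑' k : ℕ, ((w k : ℝ) : ℂ) * x ^ k with hF
  have hbound : ∀ x : ℂ, ‖x‖ ≤ R → ∀ k, ‖((w k : ℝ) : ℂ) * x ^ k‖ ≤ |w k| * R ^ k := by
    intro x hx k
    rw [norm_mul, norm_pow, Complex.norm_real, Real.norm_eq_abs]
    gcongr
  have hdiff : DifferentiableOn ℂ F (Metric.ball 0 R) := by
    apply Complex.differentiableOn_tsum_of_summable_norm hs
    · intro k; fun_prop
    · exact Metric.isOpen_ball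
    · intro k x hx
      exact hbound x (by simpa using (Metric.mem_ball.1 hx).le) k
  have hcb : Metric.closedBall (0:ℂ) 1 ⊆ Metric.ball 0 R := Metric.closedBall_subset_ball hR
  set σ := ⨆ z : Metric.sphere (0 : ℂ) 1, ‖∑' k : ℕ, ((w k : ℝ) : ℂ) * ((z : ℂ)⁻¹) ^ k‖ with hσ
  have hsphere : ∀ x : ℂ, ‖x‖ = 1 → ‖F x‖ ≤ σ := by
    intro x hx
    have hb : BddAbove (Set.range (fun z : Metric.sphere (0 : ℂ) 1 =>
        ‖∑' k : ℕ, ((w k : ℝ) : ℂ) * ((z : ℂ)⁻¹) ^ k‖)) := by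
      refine ⟨∑' k, |w k| * R ^ k, ?_⟩
      rintro _ ⟨z, rfl⟩
      refine tsum_of_norm_bounded hs.hasSum (hbound _ ?_)
      have : ‖(z:ℂ)‖ = 1 := by simpa using z.2
      rw [norm_inv, this]; simp; linarith
    have := le_ciSup hb ⟨x⁻¹, by simp [hx]⟩
    rw [← hσ] at this
    simpa only [inv_inv] using this
  have hdisc : ∀ x ∈ Metric.closedBall (0:ℂ) 1, ‖F x‖ ≤ σ := by
    intro x hx
    rw [← closure_ball (0:ℂ) one_ne_zero] at hx
    refine Complex.norm_le_of_forall_mem_frontier_norm_le Metric.isBounded_ball ?_ ?_ hx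
    · apply DifferentiableOn.diffContOnCl
      rw [closure_ball (0:ℂ) one_ne_zero]
      exact hdiff.mono hcb
    · intro z hz
      rw [frontier_ball (0:ℂ) one_ne_zero] at hz
      exact hsphere z (by simpa using hz)
  -- open set where 1 + F ≠ 0
  have hopen : IsOpen (Metric.ball (0:ℂ) R ∩ F ⁻¹' {y | 1 + y ≠ 0}) := by
    apply hdiff.continuousOn.isOpen_inter_preimage Metric.isOpen_ball
    exact isOpen_ne_fun (by fun_prop) (by fun_prop)
  have hsub : Metric.closedBall (0:ℂ) 1 ⊆ Metric.ball (0:ℂ) R ∩ F ⁻¹' {y | 1 + y ≠ 0} := by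
    intro x hx
    refine ⟨hcb hx, ?_⟩
    intro h0
    have h1 := hdisc x hx
    have : F x = -1 := by linear_combination h0
    rw [this] at h1
    simp at h1
    linarith
  obtain ⟨δ, hδ, hδsub⟩ := (isCompact_closedBall (0:ℂ) 1).exists_cthickening_subset_open hopen hsub
  rw [cthickening_closedBall hδ.le zero_le_one] at hδsub
  set S : NNReal := ⟨δ + 1, by linarith⟩ with hS
  have hSpos : 0 < S := by rw [← NNReal.coe_pos]; show 0 < δ + 1; linarith
  set G : ℂ → ℂ := fun x => (1 + F x)⁻¹ with hG
  have hGd : DifferentiableOn ℂ G (Metric.closedBall 0 (S:ℝ)) := by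
    intro x hx
    have hx' := hδsub hx
    apply DifferentiableWithinAt.inv
    · apply DifferentiableWithinAt.const_add
      exact (hdiff x hx'.1).mono (fun y hy => (hδsub hy).1)
    · exact hx'.2
  have hps := hGd.hasFPowerSeriesOnBall hSpos
  set P := cauchyPowerSeries G 0 S with hP
  set q : ℕ → ℂ := fun n => P.coeff n with hq
  -- decay of q
  set T : NNReal := ⟨δ / 2 + 1, by linarith⟩ with hT
  have hTS : (T : ENNReal) < S := by
    rw [ENNReal.coe_lt_coe, ← NNReal.coe_lt_coe]; show δ / 2 + 1 < δ + 1; linarith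
  have hqs : Summable (fun n => ‖q n‖ * (T:ℝ) ^ n) := by
    have := P.summable_norm_mul_pow (hTS.trans_le hps.r_le)
    simpa [hq, FormalMultilinearSeries.norm_apply_eq_norm_coef] using this
  have hGsum : ∀ᶠ z in nhds (0:ℂ), HasSum (fun n => z ^ n * q n) (G z) := by
    have := hasFPowerSeriesAt_iff.1 hps.hasFPowerSeriesAt
    simpa using this
  set a : ℕ → ℝ := fun k => (if k = 0 then (1:ℝ) else 0) + w k with ha
  have hz1 : ∀ᶠ z in nhds (0:ℂ), ‖z‖ < 1 := by
    have := Metric.ball_mem_nhds (0:ℂ) one_pos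
    filter_upwards [this] with z hz
    simpa using hz
  have hT1 : (1:ℝ) ≤ T := by show 1 ≤ δ / 2 + 1; linarith
  have hprod : ∀ᶠ z in nhds (0:ℂ), HasSum (fun n => z ^ n *
      (∑ j ∈ range (n + 1), ((a j : ℝ) : ℂ) * q (n - j))) ((fun _ => (1:ℂ)) z) := by
    filter_upwards [hGsum, hz1] with z hz hz1
    have hzR : ‖z‖ ≤ R := by linarith
    have hwn : Summable (fun k => ‖((w k : ℝ) : ℂ) * z ^ k‖) :=
      Summable.of_nonneg_of_le (fun _ => norm_nonneg _) (hbound z hzR) hs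
    have hd : HasSum (fun k => ((if k = 0 then (1:ℂ) else 0)) * z ^ k) 1 := by
      have := hasSum_single (f := fun k => ((if k = 0 then (1:ℂ) else 0)) * z ^ k) 0
        (by intro k hk; simp [hk])
      simpa using this
    have hdn : Summable (fun k => ‖((if k = 0 then (1:ℂ) else 0)) * z ^ k‖) := by
      apply summable_of_ne_finset_zero (s := {0})
      intro k hk; simp at hk; simp [hk]
    have haE : ∀ k, ((a k : ℝ) : ℂ) * z ^ k
        = (if k = 0 then (1:ℂ) else 0) * z ^ k + ((w k : ℝ) : ℂ) * z ^ k := by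
      intro k; simp only [ha]; push_cast; split_ifs <;> simp <;> ring
    have han : Summable (fun k => ‖((a k : ℝ) : ℂ) * z ^ k‖) := by
      refine Summable.of_nonneg_of_le (fun _ => norm_nonneg _) (fun k => ?_) (hdn.add hwn)
      rw [haE]; exact norm_add_le _ _
    have hasum : ∑' k, ((a k : ℝ) : ℂ) * z ^ k = 1 + F z := by
      simp only [haE]
      rw [(hd.summable).tsum_add hwn.of_norm, hd.tsum_eq]
    have hqn : Summable (fun k => ‖z ^ k * q k‖) := by
      refine Summable.of_nonneg_of_le (fun _ => norm_nonneg _) (fun k => ?_) hqs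
      rw [norm_mul, norm_pow, mul_comm]
      gcongr
      linarith
    have hmul := tsum_mul_tsum_eq_tsum_sum_range_of_summable_norm han hqn
    have hsm := (summable_norm_sum_mul_range_of_summable_norm han hqn).of_norm
    have hne : 1 + F z ≠ 0 := (hsub (by simpa using hz1.le)).2
    rw [hasum, hz.tsum_eq, hG, mul_inv_cancel₀ hne] at hmul
    have hfin := hsm.hasSum
    rw [← hmul] at hfin
    suffices hfe : (fun n => z ^ n * (∑ j ∈ range (n + 1), ((a j : ℝ) : ℂ) * q (n - j)))
        = fun n => ∑ k ∈ range (n + 1), ((a k : ℝ) : ℂ) * z ^ k * (z ^ (n - k) * q (n - k)) by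
      rw [hfe]; exact hfin
    funext n
    rw [Finset.mul_sum]
    apply Finset.sum_congr rfl
    intro j hj
    have : n = j + (n - j) := by simp at hj; omega
    rw [show z ^ n = z ^ (j + (n - j)) by rw [← this], pow_add]
    ring
  have hone : ∀ᶠ z in nhds (0:ℂ), HasSum (fun n => z ^ n *
      ((fun k => if k = 0 then (1:ℂ) else 0) n)) ((fun _ => (1:ℂ)) z) := by
    refine Filter.Eventually.of_forall (fun z => ?_)
    have := hasSum_single (f := fun k => z ^ k * ((if k = 0 then (1:ℂ) else 0))) 0
        (by intro k hk; simp [hk])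
    simpa using this
  have hid := coeff_unique hprod hone
  refine ⟨fun n => (q n).re, ⟨T, ?_, ?_⟩, ?_⟩
  · show 1 < δ / 2 + 1; linarith
  · refine Summable.of_nonneg_of_le (fun _ => by positivity) (fun k => ?_) hqs
    gcongr
    exact Complex.abs_re_le_norm _
  · funext n
    have := congrArg Complex.re (congrFun hid n)
    simp only [Complex.re_sum, Complex.re_ofReal_mul] at this
    unfold conv
    rw [this]
    split_ifs <;> simp

lemma mk_conv (f g : ℕ → ℝ) :
    PowerSeries.mk (conv f g) = PowerSeries.mk f * PowerSeries.mk g := by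
  ext k
  rw [PowerSeries.coeff_mul, PowerSeries.coeff_mk,
    Finset.Nat.sum_antidiagonal_eq_sum_range_succ_mk]
  simp [conv]

lemma mk_inj {f g : ℕ → ℝ} (h : PowerSeries.mk f = PowerSeries.mk g) : f = g := by
  funext k
  have := congrArg (PowerSeries.coeff k) h
  simpa using this

lemma mk_delta : PowerSeries.mk (fun k => if k = 0 then (1:ℝ) else 0) = 1 := by
  ext k; simp [PowerSeries.coeff_one]

lemma mk_add' (f g : ℕ → ℝ) :
    PowerSeries.mk (fun k => f k + g k) = PowerSeries.mk f + PowerSeries.mk g := by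
  ext k; simp

lemma conv_row (f1 f2 h u : ℕ → ℝ) (k : ℕ) :
    ∑ j ∈ range (k + 1), (f1 j * u (k - j) + f2 j * conv h u (k - j))
      = conv (fun k => f1 k + conv f2 h k) u k := by
  have h1 : conv (fun k => f1 k + conv f2 h k) u = fun k => conv f1 u k + conv f2 (conv h u) k := by
    apply mk_inj
    rw [mk_add', mk_conv, mk_add', mk_conv, mk_conv, mk_conv, mk_conv]
    ring
  rw [h1, Finset.sum_add_distrib]
  rfl

lemma quad_form (g11 g12 g21 g22 h u : ℕ → ℝ) (m : ℝ) (k : ℕ) :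
    (sisoFiltered (fun j => !![g11 j, g12 j; g21 j, g22 j]) u (conv h u) k) ⬝ᵥ
      (!![m, 0; 0, -1] : Matrix (Fin 2) (Fin 2) ℝ).mulVec
        (sisoFiltered (fun j => !![g11 j, g12 j; g21 j, g22 j]) u (conv h u) k)
    = m * conv (fun k => g11 k + conv g12 h k) u k ^ 2
      - conv (fun k => g21 k + conv g22 h k) u k ^ 2 := by
  have e0 : sisoFiltered (fun j => !![g11 j, g12 j; g21 j, g22 j]) u (conv h u) k 0
      = conv (fun k => g11 k + conv g12 h k) u k := by
    rw [← conv_row]; simp [sisoFiltered, Finset.sum_apply, mul_comm]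
  have e1 : sisoFiltered (fun j => !![g11 j, g12 j; g21 j, g22 j]) u (conv h u) k 1
      = conv (fun k => g21 k + conv g22 h k) u k := by
    rw [← conv_row]; simp [sisoFiltered, Finset.sum_apply, mul_comm]
  simp only [dotProduct, Matrix.mulVec, Fin.sum_univ_two, e0, e1]
  simp
  ring

/-- for a stable causal SISO system and a stable causal filter `Ψ` with
stably invertible `Ψ₁₁` and `‖Ψ₁₂ G Ψ₁₁⁻¹‖_∞ < 1`, satisfaction of the `L`-IQC with gain `γ`
implies satisfaction of the infinite-horizon IQC with gain `γ + O(1/L²)`. -/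
theorem statement10 {nG : ℕ} (A : Matrix (Fin nG) (Fin nG) ℝ) (B : Fin nG → ℝ)
    (C : Fin nG → ℝ) (D : ℝ) (hA : SpecRadLtOne A)
    (g11 g12 g21 g22 : ℕ → ℝ)
    (h11 : HasStableRealization g11) (h12 : HasStableRealization g12)
    (h21 : HasStableRealization g21) (h22 : HasStableRealization g22)
    (φ : ℕ → ℝ) (hφ : HasStableRealization φ)
    (hφinv : conv g11 φ = fun k => if k = 0 then (1 : ℝ) else 0)
    (hsmall : (⨆ z : Metric.sphere (0 : ℂ) 1,
      ‖∑' k : ℕ, ((conv (conv g12 (impulse A B C D)) φ k : ℝ) : ℂ) * ((z : ℂ)⁻¹) ^ k‖) < 1) :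
    ∃ c : ℝ, 0 ≤ c ∧ ∀ L : ℕ, 1 ≤ L → ∀ γ : ℝ, 0 ≤ γ →
      SatisfiesLIQCsiso (impulse A B C D) L
        (fun j => !![g11 j, g12 j; g21 j, g22 j]) !![γ ^ 2, 0; 0, -1] →
      SatisfiesIQCsiso (impulse A B C D)
        (fun j => !![g11 j, g12 j; g21 j, g22 j])
        !![(γ + c / (L : ℝ) ^ 2) ^ 2, 0; 0, -1] := by
  set h := impulse A B C D with hh
  have dh : Dec h := dec_impulse A B C D hA
  have d12 := dec_of_stable h12
  have d21 := dec_of_stable h21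
  have d22 := dec_of_stable h22
  have dφ := dec_of_stable hφ
  obtain ⟨p, dp, hp⟩ := dec_inv _ (dec_conv (dec_conv d12 dh) dφ) hsmall
  set a : ℕ → ℝ := fun k => g11 k + conv g12 h k with ha
  set b : ℕ → ℝ := fun k => g21 k + conv g22 h k with hb
  set t : ℕ → ℝ := conv b (conv φ p) with ht
  have dt : Dec t := dec_conv (dec_add d21 (dec_conv d22 dh)) (dec_conv dφ dp)
  have hinv : PowerSeries.mk a * (PowerSeries.mk φ * PowerSeries.mk p) = 1 := by
    have e1 : PowerSeries.mk g11 * PowerSeries.mk φ = 1 := by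
      rw [← mk_conv, hφinv, mk_delta]
    have e2 := congrArg PowerSeries.mk hp
    rw [mk_conv, mk_add', mk_delta, mk_conv, mk_conv] at e2
    rw [ha, mk_add', mk_conv]
    linear_combination e2 + PowerSeries.mk p * e1
  have hmom := dec_moment dt
  set c := 36 * ∑' j, |t j| * (j:ℝ)^3 + 1 with hc
  have hc0 : 0 < c := by
    have : 0 ≤ ∑' j, |t j| * (j:ℝ)^3 := tsum_nonneg (fun j => by positivity)
    linarith
  refine ⟨c, hc0.le, ?_⟩
  intro L hL γ hγ hLI u _ H
  have hfin : ∀ v : ℕ → ℝ, ∑ k ∈ range L, conv t v k ^ 2 ≤ γ ^ 2 * ∑ k ∈ range L, v k ^ 2 := by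
    intro v
    have h1 := hLI (conv (conv φ p) v) (L - 1) (by omega)
    simp only [quad_form] at h1
    have ea : conv a (conv (conv φ p) v) = v := by
      apply mk_inj
      rw [mk_conv, mk_conv, mk_conv]
      linear_combination PowerSeries.mk v * hinv
    have eb : conv b (conv (conv φ p) v) = conv t v := by
      apply mk_inj
      simp only [ht, mk_conv]
      ring
    rw [← ha, ← hb, ea, eb, Nat.sub_add_cancel hL, Finset.sum_sub_distrib, ← Finset.mul_sum] at h1
    linarith
  have hgain := main_gain t c (fun N => by
    have := hmom.sum_le_tsum (range N) (fun j _ => by positivity)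
    linarith) hc0 L hL γ hγ hfin (H + 1) (conv a u)
  have et : conv t (conv a u) = conv b u := by
    apply mk_inj
    simp only [ht, mk_conv]
    linear_combination PowerSeries.mk b * PowerSeries.mk u * hinv
  rw [et] at hgain
  simp only [quad_form]
  rw [← ha, ← hb, Finset.sum_sub_distrib, ← Finset.mul_sum]
  linarith
end

section
/- Let a : {z ∈ ℂ : |z| = 1} → ℂ^{m×m} be a continuous matrix-valued function with Fourier coefficients a_k, and for L ≥ 1 let T_L(a) = (a_{i−j})_{i,j=0}^{L−1} ∈ ℂ^{mL×mL} be the finite Toeplitz section with operator norm ‖T_L(a)‖ on ℂ^{mL} with the Euclidean norm. Then the sequence L ↦ ‖T_L(a)‖ is nondecreasing in L, is bounded above by ‖a‖_∞ := sup_{|z|=1} ‖a(z)‖, and converges to ‖a‖_∞ as L → ∞; in particular sup_{L} ‖T_L(a)‖ = ‖a‖_∞, so the finite-horizon input-output gains recover the exact infinite-horizon operator gain in the limit. -/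
open Matrix Finset Filter

/-- The spectral norm (ℓ²-operator norm) of a complex matrix. -/
noncomputable def specNorm {ι : Type*} [Fintype ι] [DecidableEq ι] (M : Matrix ι ι ℂ) : ℝ :=
  ‖Matrix.toEuclideanCLM (𝕜 := ℂ) M‖

/-- The `k`-th (matrix) Fourier coefficient of a matrix-valued function on the unit circle:
`a_k = (1/2π) ∫₀^{2π} a(e^{iθ}) e^{-ikθ} dθ`. -/
noncomputable def fourierCoeff' {m : ℕ} (a : ℂ → Matrix (Fin m) (Fin m) ℂ) (k : ℤ) :
    Matrix (Fin m) (Fin m) ℂ :=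
  fun s t => (2 * (Real.pi : ℂ))⁻¹ *
    ∫ θ in (0 : ℝ)..(2 * Real.pi),
      a (Complex.exp (θ * Complex.I)) s t * Complex.exp (-(k : ℂ) * θ * Complex.I)

/-- The finite block Toeplitz section `T_L(a) = (a_{i-j})_{i,j=0}^{L-1}`. -/
noncomputable def toeplitzSection {m : ℕ} (L : ℕ) (a : ℂ → Matrix (Fin m) (Fin m) ℂ) :
    Matrix (Fin L × Fin m) (Fin L × Fin m) ℂ :=
  fun is js => fourierCoeff' a ((is.1 : ℤ) - (js.1 : ℤ)) is.2 js.2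

section helpers

open MeasureTheory ComplexConjugate

/-- The unit sphere of the complex plane. -/
abbrev Sph : Type := Metric.sphere (0 : ℂ) 1

/-- Sesquilinear form of a matrix. -/
noncomputable def sesq {ι : Type*} [Fintype ι] (M : Matrix ι ι ℂ) (y x : ι → ℂ) : ℂ :=
  ∑ p, ∑ q, conj (y p) * M p q * x q

/-- Squared Euclidean norm. -/
noncomputable def nsq {ι : Type*} [Fintype ι] (x : ι → ℂ) : ℝ := ∑ p, ‖x p‖ ^ 2

lemma nsq_eq {ι : Type*} [Fintype ι] (x : ι → ℂ) : nsq x = ‖WithLp.toLp 2 x‖ ^ 2 := by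
  rw [EuclideanSpace.norm_sq_eq]; rfl

lemma sesq_eq {ι : Type*} [Fintype ι] [DecidableEq ι] (M : Matrix ι ι ℂ) (y x : ι → ℂ) :
    sesq M y x = inner ℂ (WithLp.toLp 2 y)
      (Matrix.toEuclideanCLM (𝕜 := ℂ) M (WithLp.toLp 2 x)) := by
  rw [Matrix.toEuclideanCLM_toLp, PiLp.inner_apply]
  simp only [sesq, Matrix.mulVec, dotProduct, RCLike.inner_apply, Finset.sum_mul]
  refine Finset.sum_congr rfl fun p _ => Finset.sum_congr rfl fun q _ => ?_
  ring

lemma specNorm_nonneg {ι : Type*} [Fintype ι] [DecidableEq ι] (M : Matrix ι ι ℂ) :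
    0 ≤ specNorm M := norm_nonneg _

lemma sesq_le {ι : Type*} [Fintype ι] [DecidableEq ι] (M : Matrix ι ι ℂ) (y x : ι → ℂ) :
    ‖sesq M y x‖ ≤ specNorm M * ((nsq y + nsq x) / 2) := by
  rw [sesq_eq, nsq_eq, nsq_eq]
  set X := WithLp.toLp 2 x
  set Y := WithLp.toLp 2 y
  have h1 := norm_inner_le_norm (𝕜 := ℂ) Y (Matrix.toEuclideanCLM (𝕜 := ℂ) M X)
  have h2 := (Matrix.toEuclideanCLM (𝕜 := ℂ) M).le_opNorm X
  have h3 : ‖Y‖ * ‖X‖ ≤ (‖Y‖ ^ 2 + ‖X‖ ^ 2) / 2 := by nlinarith [sq_nonneg (‖Y‖ - ‖X‖)]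
  calc _ ≤ ‖Y‖ * (specNorm M * ‖X‖) := h1.trans (by gcongr; exact h2)
    _ = specNorm M * (‖Y‖ * ‖X‖) := by ring
    _ ≤ _ := by gcongr; exact specNorm_nonneg M

lemma specNorm_le {ι : Type*} [Fintype ι] [DecidableEq ι] (M : Matrix ι ι ℂ) {C : ℝ}
    (hC : 0 ≤ C) (h : ∀ y x : ι → ℂ, nsq y = 1 → nsq x = 1 → ‖sesq M y x‖ ≤ C) :
    specNorm M ≤ C := by
  refine ContinuousLinearMap.opNorm_le_of_unit_norm hC fun x hx => ?_
  set T := Matrix.toEuclideanCLM (𝕜 := ℂ) M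
  by_cases hTx : ‖T x‖ = 0
  · rwa [hTx]
  · have := h (WithLp.ofLp (((‖T x‖⁻¹ : ℝ) : ℂ) • T x)) (WithLp.ofLp x)
      (by rw [nsq_eq, WithLp.toLp_ofLp, norm_smul]; simp [hTx])
      (by rw [nsq_eq, WithLp.toLp_ofLp, hx]; simp)
    rw [sesq_eq, WithLp.toLp_ofLp, WithLp.toLp_ofLp, inner_smul_left,
      inner_self_eq_norm_sq_to_K] at this
    simp only [Complex.conj_ofReal, norm_mul, norm_pow] at this
    have e : ‖((‖T x‖⁻¹ : ℝ) : ℂ)‖ * ‖((‖T x‖ : ℝ) : ℂ)‖ ^ 2 = ‖T x‖ := by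
      simp; field_simp
    exact e ▸ this

lemma specNorm_submatrix_le {ι κ : Type*} [Fintype ι] [DecidableEq ι] [Fintype κ] [DecidableEq κ]
    (M : Matrix κ κ ℂ) (e : ι → κ) (he : Function.Injective e) :
    specNorm (M.submatrix e e) ≤ specNorm M := by
  refine specNorm_le _ (specNorm_nonneg M) fun y x hy hx => ?_
  have hn : ∀ x : ι → ℂ, nsq (Function.extend e x 0) = nsq x := by
    intro x
    refine (Fintype.sum_of_injective e he _ _ (fun i hi => ?_) fun i => ?_).symm
    · rw [Function.extend_apply' _ _ _ (by simpa using hi)]; simp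
    · rw [he.extend_apply]
  have hs : sesq M (Function.extend e y 0) (Function.extend e x 0) = sesq (M.submatrix e e) y x := by
    refine (Fintype.sum_of_injective e he _ _ (fun i hi => ?_) fun i => ?_).symm
    · rw [Function.extend_apply' _ _ _ (by simpa using hi)]; simp
    · refine Fintype.sum_of_injective e he _ _ (fun j hj => ?_) fun j => ?_
      · rw [Function.extend_apply' x _ _ (by simpa using hj)]; simp
      · rw [he.extend_apply, he.extend_apply]; rfl
  have := sesq_le M (Function.extend e y 0) (Function.extend e x 0)
  rw [hn, hn, hs, hx, hy] at this
  linarith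

/-- Parametrization of the circle. -/
noncomputable def par (θ : ℝ) : Sph :=
  ⟨Complex.exp (θ * Complex.I), by simp [Complex.norm_exp_ofReal_mul_I]⟩

lemma continuous_par : Continuous par := by
  unfold par
  fun_prop

/-- Normalized measure on the circle. -/
noncomputable def nu : Measure Sph :=
  ENNReal.ofReal (2 * Real.pi)⁻¹ • (volume.restrict (Set.Ioc 0 (2 * Real.pi))).map par

instance : IsFiniteMeasure nu := by
  unfold nu
  exact Measure.smul_finite _ ENNReal.ofReal_ne_top

lemma integral_nu {E : Type*} [NormedAddCommGroup E] [NormedSpace ℝ E]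
    [SecondCountableTopology E] [MeasurableSpace E] [BorelSpace E] {f : Sph → E}
    (hf : Continuous f) :
    ∫ z, f z ∂nu = (2 * Real.pi)⁻¹ • ∫ θ in (0 : ℝ)..(2 * Real.pi), f (par θ) := by
  have : (0 : ℝ) ≤ 2 * Real.pi := by positivity
  rw [nu, integral_smul_measure, integral_map continuous_par.aemeasurable
    hf.aestronglyMeasurable, intervalIntegral.integral_of_le this, ENNReal.toReal_ofReal
    (by positivity)]

lemma integrable_nu {E : Type*} [NormedAddCommGroup E] {f : Sph → E}
    (hf : Continuous f) : Integrable f nu :=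
  hf.integrable_of_hasCompactSupport (HasCompactSupport.of_compactSpace f)

lemma sph_norm (z : Sph) : ‖(z : ℂ)‖ = 1 := by simpa using z.2

lemma sph_ne (z : Sph) : (z : ℂ) ≠ 0 := by
  intro h; have := sph_norm z; simp [h] at this

lemma continuous_zpow_sph (k : ℤ) : Continuous fun z : Sph => (z : ℂ) ^ k :=
  continuous_subtype_val.zpow₀ k fun z => Or.inl (sph_ne z)

lemma par_zpow (θ : ℝ) (k : ℤ) : (par θ : ℂ) ^ k = Complex.exp (k * θ * Complex.I) := by
  rw [par, ← Complex.exp_int_mul]; ring_nf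

lemma coeff_eq {m : ℕ} (a : ℂ → Matrix (Fin m) (Fin m) ℂ)
    (ha : Continuous fun z : Sph => a z) (k : ℤ) (s t : Fin m) :
    fourierCoeff' a k s t = ∫ z : Sph, a z s t * (z : ℂ) ^ (-k) ∂nu := by
  have hcont : Continuous fun z : Sph => a z s t * (z : ℂ) ^ (-k) :=
    (ha.matrix_elem s t).mul (continuous_zpow_sph _)
  rw [integral_nu hcont]
  simp only [par_zpow]
  simp [fourierCoeff', par]

lemma integral_zpow_sph (k : ℤ) : ∫ z : Sph, (z : ℂ) ^ k ∂nu = if k = 0 then 1 else 0 := by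
  rw [integral_nu (continuous_zpow_sph k)]
  simp only [par_zpow]
  have hpi := Real.pi_ne_zero
  split_ifs with hk
  · subst hk
    simp
    have hpi' : (Real.pi : ℂ) ≠ 0 := by exact_mod_cast hpi
    field_simp
  · have : ∀ θ : ℝ, Complex.exp (k * θ * Complex.I) = Complex.exp ((k * Complex.I) * θ) :=
      fun θ => by ring_nf
    simp only [this]
    rw [integral_exp_mul_complex (by simp [hk])]
    have e : Complex.exp (k * Complex.I * ((2 * Real.pi : ℝ) : ℂ)) = 1 := by
      rw [Complex.exp_eq_one_iff]; exact ⟨k, by push_cast; ring⟩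
    rw [e]; simp

/-- Trigonometric polynomial with vector coefficients. -/
noncomputable def trig {m L : ℕ} (x : Fin L × Fin m → ℂ) (z : Sph) (t : Fin m) : ℂ :=
  ∑ j : Fin L, x (j, t) * (z : ℂ) ^ (j : ℕ)

lemma continuous_trig {m L : ℕ} (x : Fin L × Fin m → ℂ) (t : Fin m) :
    Continuous fun z => trig x z t := by
  unfold trig
  fun_prop

lemma trig_pointwise {m L : ℕ} (A : Matrix (Fin m) (Fin m) ℂ) (y x : Fin L × Fin m → ℂ)
    (z : Sph) :
    sesq A (trig y z) (trig x z) = ∑ p : Fin L × Fin m, ∑ q : Fin L × Fin m,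
      conj (y p) * (A p.2 q.2 * (z : ℂ) ^ (-((p.1 : ℤ) - (q.1 : ℤ)))) * x q := by
  have hc : ∀ i j : ℕ, (z : ℂ) ^ (-((i : ℤ) - (j : ℤ))) = conj ((z : ℂ) ^ i) * (z : ℂ) ^ j := by
    intro i j
    have : conj (z : ℂ) = (z : ℂ)⁻¹ := by
      rw [Complex.inv_def, Complex.normSq_eq_norm_sq, sph_norm]; simp
    rw [map_pow, this, neg_sub, zpow_sub₀ (sph_ne z), div_eq_mul_inv]
    simp [mul_comm]
  simp only [hc, sesq, trig, map_sum, map_mul, Fintype.sum_prod_type_right]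
  refine Finset.sum_congr rfl fun s _ => ?_
  rw [Finset.sum_comm]
  refine Finset.sum_congr rfl fun t _ => ?_
  rw [Finset.sum_mul, Finset.sum_mul]
  refine Finset.sum_congr rfl fun i _ => ?_
  rw [Finset.mul_sum]
  refine Finset.sum_congr rfl fun j _ => ?_
  ring

lemma sesq_toeplitz {m L : ℕ} (a : ℂ → Matrix (Fin m) (Fin m) ℂ)
    (ha : Continuous fun z : Sph => a z) (y x : Fin L × Fin m → ℂ) :
    sesq (toeplitzSection L a) y x = ∫ z : Sph, sesq (a z) (trig y z) (trig x z) ∂nu := by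
  have hcont : ∀ p q : Fin L × Fin m, Continuous fun z : Sph =>
      conj (y p) * (a z p.2 q.2 * (z : ℂ) ^ (-((p.1 : ℤ) - (q.1 : ℤ)))) * x q := fun p q =>
    (continuous_const.mul ((ha.matrix_elem _ _).mul (continuous_zpow_sph _))).mul continuous_const
  simp only [trig_pointwise]
  rw [integral_finset_sum _ fun p _ => integrable_finset_sum _ fun q _ =>
    integrable_nu (hcont p q)]
  refine Finset.sum_congr rfl fun p _ => ?_
  rw [integral_finset_sum _ fun q _ => integrable_nu (hcont p q)]
  refine Finset.sum_congr rfl fun q _ => ?_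
  rw [integral_mul_const, integral_const_mul, toeplitzSection, coeff_eq a ha]

lemma sesq_one {ι : Type*} [Fintype ι] [DecidableEq ι] (x : ι → ℂ) :
    sesq (1 : Matrix ι ι ℂ) x x = (nsq x : ℂ) := by
  simp only [sesq, nsq, Matrix.one_apply]
  push_cast
  refine Finset.sum_congr rfl fun p _ => ?_
  simp [Complex.conj_mul']

lemma toeplitz_one {m L : ℕ} : toeplitzSection L (fun _ => (1 : Matrix (Fin m) (Fin m) ℂ)) = 1 := by
  ext p q
  rw [toeplitzSection, coeff_eq _ continuous_const, integral_const_mul, integral_zpow_sph]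
  rcases p with ⟨i, s⟩
  rcases q with ⟨j, t⟩
  simp only [Matrix.one_apply, Prod.mk.injEq]
  have : (-((i : ℤ) - (j : ℤ)) = 0) ↔ i = j := by
    rw [Fin.ext_iff]; omega
  simp only [this]
  by_cases h : i = j <;> by_cases h' : s = t <;> simp [h, h']

lemma continuous_nsq_trig {m L : ℕ} (x : Fin L × Fin m → ℂ) :
    Continuous fun z => nsq (trig x z) := by
  unfold nsq
  exact continuous_finset_sum _ fun t _ => (continuous_trig x t).norm.pow 2

lemma parseval {m L : ℕ} (x : Fin L × Fin m → ℂ) : ∫ z, nsq (trig x z) ∂nu = nsq x := by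
  have h := sesq_toeplitz (fun _ => (1 : Matrix (Fin m) (Fin m) ℂ)) continuous_const x x
  rw [toeplitz_one, sesq_one] at h
  simp only [sesq_one] at h
  have h2 : ∫ z, ((nsq (trig x z) : ℝ) : ℂ) ∂nu = ((∫ z, nsq (trig x z) ∂nu : ℝ) : ℂ) :=
    integral_ofReal
  rw [h2] at h
  exact (Complex.ofReal_injective h).symm

lemma toeplitz_le {m L : ℕ} (a : ℂ → Matrix (Fin m) (Fin m) ℂ)
    (ha : Continuous fun z : Sph => a z) {C : ℝ} (hC0 : 0 ≤ C)
    (hC : ∀ z : Sph, specNorm (a z) ≤ C) : specNorm (toeplitzSection L a) ≤ C := by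
  refine specNorm_le _ hC0 fun y x hy hx => ?_
  rw [sesq_toeplitz a ha]
  have hi : Integrable (fun z => C * ((nsq (trig y z) + nsq (trig x z)) / 2)) nu :=
    integrable_nu (continuous_const.mul
      (((continuous_nsq_trig y).add (continuous_nsq_trig x)).div_const 2))
  refine (norm_integral_le_of_norm_le hi (Eventually.of_forall fun z => ?_)).trans ?_
  · refine (sesq_le _ _ _).trans ?_
    refine mul_le_mul_of_nonneg_right (hC z) ?_
    have : ∀ w : Fin m → ℂ, 0 ≤ nsq w := fun w => by unfold nsq; positivity
    linarith [this (trig y z), this (trig x z)]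
  · rw [integral_const_mul, integral_div, integral_add (integrable_nu (continuous_nsq_trig y))
      (integrable_nu (continuous_nsq_trig x)), parseval, parseval, hx, hy]
    linarith

/-- Dirichlet-type kernel centred at `w`. -/
noncomputable def dir (L : ℕ) (w z : Sph) : ℂ := ∑ j : Fin L, ((z : ℂ) / w) ^ (j : ℕ)

/-- Test vector. -/
noncomputable def tv {m : ℕ} (L : ℕ) (w : Sph) (u : Fin m → ℂ) (p : Fin L × Fin m) : ℂ :=
  u p.2 * ((w : ℂ)⁻¹) ^ (p.1 : ℕ)

lemma trig_tv {m L : ℕ} (w z : Sph) (u : Fin m → ℂ) (t : Fin m) :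
    trig (tv L w u) z t = u t * dir L w z := by
  simp only [trig, tv, dir, Finset.mul_sum, div_eq_mul_inv, mul_pow]
  refine Finset.sum_congr rfl fun j _ => ?_
  ring

lemma nsq_tv {m L : ℕ} (w : Sph) (u : Fin m → ℂ) : nsq (tv L w u) = L * nsq u := by
  simp [nsq, tv, Fintype.sum_prod_type, sph_norm]

lemma continuous_dir (L : ℕ) (w : Sph) : Continuous (dir L w) := by
  unfold dir
  fun_prop

lemma integral_dir (L : ℕ) (w : Sph) : ∫ z, ‖dir L w z‖ ^ 2 ∂nu = L := by
  have h := parseval (tv L w (fun _ : Fin 1 => (1 : ℂ)))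
  rw [nsq_tv] at h
  simpa [nsq, trig_tv] using h

lemma sesq_tv {m L : ℕ} (a : ℂ → Matrix (Fin m) (Fin m) ℂ)
    (ha : Continuous fun z : Sph => a z) (w : Sph) (v u : Fin m → ℂ) :
    sesq (toeplitzSection L a) (tv L w v) (tv L w u) =
      ∫ z : Sph, ((‖dir L w z‖ ^ 2 : ℝ) : ℂ) * sesq (a z) v u ∂nu := by
  rw [sesq_toeplitz a ha]
  congr 1
  ext z
  simp only [sesq, trig_tv, Finset.mul_sum, map_mul]
  refine Finset.sum_congr rfl fun p _ => Finset.sum_congr rfl fun q _ => ?_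
  push_cast
  rw [← Complex.conj_mul']
  ring

lemma dir_bound (L : ℕ) (w z : Sph) (h : z ≠ w) : ‖dir L w z‖ ≤ 2 / dist z w := by
  have hne : (z : ℂ) / w ≠ 1 := by
    rw [Ne, div_eq_one_iff_eq (sph_ne w)]
    exact fun h' => h (Subtype.ext h')
  have hd : ‖(z : ℂ) / w - 1‖ = dist z w := by
    rw [div_sub_one (sph_ne w), norm_div, sph_norm, div_one, Subtype.dist_eq, dist_eq_norm]
  rw [dir, Fin.sum_univ_eq_sum_range (fun j => ((z : ℂ) / w) ^ j), geom_sum_eq hne, norm_div, hd]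
  gcongr
  refine (norm_sub_le _ _).trans ?_
  simp [sph_norm]
  norm_num

lemma peak (g : Sph → ℂ) (hg : Continuous g) (w : Sph) :
    Tendsto (fun L : ℕ => ∫ z, ((L : ℝ)⁻¹ * ‖dir L w z‖ ^ 2) • g z ∂nu) atTop (nhds (g w)) := by
  have := tendsto_setIntegral_peak_smul_of_integrableOn_of_tendsto (μ := nu) (s := Set.univ)
    (t := Set.univ) (x₀ := w) (g := g) (a := g w) (l := atTop)
    (φ := fun (L : ℕ) z => (L : ℝ)⁻¹ * ‖dir L w z‖ ^ 2)
    MeasurableSet.univ MeasurableSet.univ subset_rfl (by simp) (measure_ne_top _ _)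
    (Eventually.of_forall fun L z _ => by positivity) ?_ ?_ ?_
    (integrable_nu hg).integrableOn (by simpa using hg.tendsto w)
  · simpa using this
  · intro U hU hw
    obtain ⟨δ, hδ, hb⟩ := Metric.isOpen_iff.1 hU w hw
    rw [Metric.tendstoUniformlyOn_iff]
    intro ε hε
    have h0 : Tendsto (fun L : ℕ => (L : ℝ)⁻¹ * (2 / δ) ^ 2) atTop (nhds (0 * (2 / δ) ^ 2)) :=
      tendsto_inv_atTop_nhds_zero_nat.mul_const _
    rw [zero_mul] at h0
    filter_upwards [h0.eventually (gt_mem_nhds hε)] with L hL z hz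
    have hz2 : δ ≤ dist z w := by
      by_contra hlt
      exact hz.2 (hb (by simpa using hlt))
    have hzw : z ≠ w := by
      rintro rfl; simp at hz2; linarith
    have hle : (L : ℝ)⁻¹ * ‖dir L w z‖ ^ 2 ≤ (L : ℝ)⁻¹ * (2 / δ) ^ 2 := by
      gcongr
      exact (dir_bound L w z hzw).trans (by gcongr)
    rw [Pi.zero_apply, dist_zero_left, Real.norm_of_nonneg (by positivity)]
    exact hle.trans_lt hL
  · refine tendsto_const_nhds.congr' ?_
    filter_upwards [eventually_gt_atTop 0] with L hL
    rw [Measure.restrict_univ, integral_const_mul, integral_dir]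
    have : (L : ℝ) ≠ 0 := by positivity
    field_simp
  · exact Eventually.of_forall fun L =>
      (continuous_const.mul ((continuous_dir L w).norm.pow 2)).aestronglyMeasurable

lemma le_of_toeplitz {m : ℕ} (a : ℂ → Matrix (Fin m) (Fin m) ℂ)
    (ha : Continuous fun z : Sph => a z) {C : ℝ} (hC0 : 0 ≤ C)
    (hC : ∀ L, specNorm (toeplitzSection L a) ≤ C) (w : Sph) : specNorm (a w) ≤ C := by
  refine specNorm_le _ hC0 fun v u hv hu => ?_
  have hg : Continuous fun z : Sph => sesq (a z) v u := by
    unfold sesq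
    exact continuous_finset_sum _ fun p _ => continuous_finset_sum _ fun q _ =>
      (continuous_const.mul (ha.matrix_elem p q)).mul continuous_const
  refine le_of_tendsto (peak _ hg w).norm ?_
  filter_upwards [eventually_gt_atTop 0] with L hL
  have hL' : (0 : ℝ) < L := by exact_mod_cast hL
  have h := sesq_le (toeplitzSection L a) (tv L w v) (tv L w u)
  rw [nsq_tv, nsq_tv, hv, hu, sesq_tv a ha] at h
  have e : ∫ z, ((L : ℝ)⁻¹ * ‖dir L w z‖ ^ 2) • sesq (a z) v u ∂nu =
      ((L : ℝ)⁻¹ : ℂ) * ∫ z : Sph, ((‖dir L w z‖ ^ 2 : ℝ) : ℂ) * sesq (a z) v u ∂nu := by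
    rw [← integral_const_mul]
    congr 1
    ext z
    rw [Complex.real_smul]
    push_cast
    ring
  rw [e, norm_mul]
  have e2 : ‖((L : ℝ)⁻¹ : ℂ)‖ = (L : ℝ)⁻¹ := by simp
  rw [e2, inv_mul_le_iff₀ hL']
  have := mul_le_mul_of_nonneg_right (hC L) hL'.le
  linarith

lemma continuous_specNorm {m : ℕ} : Continuous (fun M : Matrix (Fin m) (Fin m) ℂ => specNorm M) := by
  unfold specNorm
  exact (LinearMap.continuous_of_finiteDimensional
    (Matrix.toEuclideanCLM (n := Fin m) (𝕜 := ℂ)).toAlgEquiv.toLinearMap).norm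

end helpers

/-- for a continuous matrix symbol `a` on the unit circle, the norms of the
finite Toeplitz sections are nondecreasing in `L`, bounded by `‖a‖_∞`, and converge to `‖a‖_∞`;
in particular their supremum equals `‖a‖_∞`. -/
theorem statement14 {m : ℕ} (a : ℂ → Matrix (Fin m) (Fin m) ℂ)
    (ha : ContinuousOn a (Metric.sphere (0 : ℂ) 1)) :
    Monotone (fun L : ℕ => specNorm (toeplitzSection L a)) ∧
    (∀ L : ℕ, specNorm (toeplitzSection L a) ≤
      ⨆ z : Metric.sphere (0 : ℂ) 1, specNorm (a (z : ℂ))) ∧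
    Tendsto (fun L : ℕ => specNorm (toeplitzSection L a)) atTop
      (nhds (⨆ z : Metric.sphere (0 : ℂ) 1, specNorm (a (z : ℂ)))) ∧
    (⨆ L : ℕ, specNorm (toeplitzSection L a)) =
      ⨆ z : Metric.sphere (0 : ℂ) 1, specNorm (a (z : ℂ)) := by
  have hc : Continuous fun z : Sph => a z := continuousOn_iff_continuous_restrict.1 ha
  have hbdd : BddAbove (Set.range fun z : Sph => specNorm (a (z : ℂ))) :=
    (isCompact_range (continuous_specNorm.comp hc)).bddAbove
  have hS0 : 0 ≤ ⨆ z : Metric.sphere (0 : ℂ) 1, specNorm (a (z : ℂ)) :=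
    Real.iSup_nonneg fun z => specNorm_nonneg _
  have hmono : Monotone (fun L : ℕ => specNorm (toeplitzSection L a)) := by
    intro L L' h
    have := specNorm_submatrix_le (toeplitzSection L' a)
      (fun p : Fin L × Fin m => ((Fin.castLE h p.1, p.2) : Fin L' × Fin m)) (by
        rintro ⟨i, s⟩ ⟨j, t⟩ hij
        simpa using hij)
    exact this
  have hle : ∀ L : ℕ, specNorm (toeplitzSection L a) ≤
      ⨆ z : Metric.sphere (0 : ℂ) 1, specNorm (a (z : ℂ)) := fun L =>
    toeplitz_le a hc hS0 fun z => le_ciSup hbdd z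
  have hb : BddAbove (Set.range fun L : ℕ => specNorm (toeplitzSection L a)) :=
    ⟨_, by rintro _ ⟨L, rfl⟩; exact hle L⟩
  have heq : (⨆ L : ℕ, specNorm (toeplitzSection L a)) =
      ⨆ z : Metric.sphere (0 : ℂ) 1, specNorm (a (z : ℂ)) := by
    haveI : Nonempty (Metric.sphere (0 : ℂ) 1) := ⟨par 0⟩
    refine le_antisymm (ciSup_le hle) (ciSup_le fun w => ?_)
    exact le_of_toeplitz a hc (Real.iSup_nonneg fun _ => specNorm_nonneg _)
      (fun L => le_ciSup hb L) w
  exact ⟨hmono, hle, heq ▸ tendsto_atTop_ciSup hmono hb, heq⟩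
end
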